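/- Rigidity of measurable solutions of the phase cohomological equation: Let Φ ∈ ℝ be irrational, θ ∈ ℝ, and let l : ℝ → ℂ be a 1-periodic measurable function, integrable on [0,1], such that l(x) = e^{4πiθ} l(x + Φ) for almost every x ∈ ℝ. If l is not almost everywhere equal to 0, then there exists j ∈ ℤ with 2θ + jΦ ∈ ℤ. -/

import Mathlib

open MeasureTheory

/-- A complex-valued integrable function on a space in which closed sets can be approximated from
outside is a.e. zero as soon as all its integrals against continuous functions vanish. -/
theorem ae_eq_zero_of_forall_integral_continuous_mul_eq_zero {X : Type*} [TopologicalSpace X]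
    [HasOuterApproxClosed X] [MeasurableSpace X] [BorelSpace X] {μ : Measure X} {f : X → ℂ}
    (hf : Integrable f μ) (h : ∀ g : C(X, ℂ), ∫ x, g x * f x ∂μ = 0) : f =ᵐ[μ] 0 := by
  refine ae_eq_zero_of_forall_setIntegral_isClosed_eq_zero hf fun s hs ↦ ?_
  let g (n : ℕ) : C(X, ℂ) := ⟨fun x ↦ ((hs.apprSeq n x : ℝ) : ℂ), by fun_prop⟩
  have key : Filter.Tendsto (fun n ↦ ∫ x, g n x * f x ∂μ) Filter.atTop
      (nhds (∫ x, s.indicator f x ∂μ)) := by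
    refine tendsto_integral_of_dominated_convergence (fun x ↦ ‖f x‖)
      (fun n ↦ (g n).continuous.aestronglyMeasurable.mul hf.1) hf.norm
      (fun n ↦ .of_forall fun x ↦ ?_) (.of_forall fun x ↦ ?_)
    · have h1 : (hs.apprSeq n x : ℝ) ≤ 1 :=
        mod_cast HasOuterApproxClosed.apprSeq_apply_le_one hs n x
      rw [norm_mul]
      refine mul_le_of_le_one_left (norm_nonneg _) ?_
      simpa [g] using h1
    · have h1 := tendsto_pi_nhds.1 (HasOuterApproxClosed.tendsto_apprSeq hs) x
      have h2 := ((Complex.continuous_ofReal.comp NNReal.continuous_coe).tendsto _).comp h1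
      have h3 : s.indicator f x = (NNReal.toReal (s.indicator (fun _ ↦ 1) x) : ℂ) * f x := by
        by_cases hx : x ∈ s <;> simp [hx]
      rw [h3]
      exact h2.mul_const (f x)
  simp_rw [h] at key
  rw [← integral_indicator hs.measurableSet]
  exact (tendsto_const_nhds_iff.1 key).symm

/-- Uniqueness of Fourier coefficients for integrable functions on the circle. -/
theorem ae_eq_zero_of_fourierCoeff_eq_zero {T : ℝ} [Fact (0 < T)] {f : AddCircle T → ℂ}
    (hf : Integrable f AddCircle.haarAddCircle) (h : ∀ n, fourierCoeff f n = 0) :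
    f =ᵐ[AddCircle.haarAddCircle] 0 := by
  refine ae_eq_zero_of_forall_integral_continuous_mul_eq_zero hf fun g ↦ ?_
  have hg (g : C(AddCircle T, ℂ)) : Integrable (fun x ↦ g x * f x) AddCircle.haarAddCircle :=
    hf.bdd_mul g.continuous.aestronglyMeasurable (.of_forall g.norm_coe_le_norm)
  let A : C(AddCircle T, ℂ) →L[ℂ] ℂ := LinearMap.mkContinuous
    { toFun := fun g ↦ ∫ x, g x * f x ∂AddCircle.haarAddCircle
      map_add' := fun g₁ g₂ ↦ by
        simp only [ContinuousMap.add_apply, add_mul]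
        exact integral_add (hg g₁) (hg g₂)
      map_smul' := fun c g ↦ by
        simp only [ContinuousMap.smul_apply, smul_eq_mul, mul_assoc, RingHom.id_apply]
        exact integral_const_mul _ _ }
    (∫ x, ‖f x‖ ∂AddCircle.haarAddCircle) fun g ↦ by
      refine (norm_integral_le_of_norm_le (hf.norm.const_mul ‖g‖) (.of_forall fun x ↦ ?_)).trans
        (by rw [integral_const_mul, mul_comm])
      rw [norm_mul]
      gcongr
      exact g.norm_coe_le_norm x
  have hA : A = 0 := by
    refine ContinuousLinearMap.ext_on (s := Set.range (@fourier T)) ?_ ?_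
    · exact Submodule.dense_iff_topologicalClosure_eq_top.2 span_fourier_closure_eq_top
    · rintro _ ⟨n, rfl⟩
      have hn := h (-n)
      rw [fourierCoeff, neg_neg] at hn
      exact hn
  exact congr($hA g)

/-- A property of points of the unit circle that holds a.e. holds a.e. on the real line. -/
theorem UnitAddCircle.ae_coe {p : UnitAddCircle → Prop} (h : ∀ᵐ x, p x) :
    ∀ᵐ x : ℝ, p x := by
  rw [← Measure.restrict_univ (μ := (volume : Measure ℝ)), ← iUnion_Ioc_intCast ℝ]
  exact (ae_restrict_iUnion_iff _ _).2 fun n ↦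
    (UnitAddCircle.measurePreserving_mk n).quasiMeasurePreserving.ae h

/-- Fourier coefficients of a solution of the twisted cohomological equation over the rotation by
`a` are fixed by multiplication by `c * fourier n a`. -/
theorem fourierCoeff_eq_mul_of_ae_eq {f : UnitAddCircle → ℂ} {a : ℝ} {c : ℂ}
    (h : ∀ᵐ x : ℝ, f x = c * f (x + a : ℝ)) (n : ℤ) :
    fourierCoeff f n = c * fourier n (a : UnitAddCircle) * fourierCoeff f n := by
  conv_lhs => rw [fourierCoeff_eq_intervalIntegral f n 0]
  rw [fourierCoeff_eq_intervalIntegral f n a]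
  have hshift := intervalIntegral.integral_comp_add_right (a := 0) (b := 1)
    (fun x : ℝ ↦ fourier (-n) (x : UnitAddCircle) • f x) a
  rw [zero_add, add_comm 1 a] at hshift
  simp only [div_one, one_smul, zero_add]
  rw [← hshift, ← intervalIntegral.integral_const_mul]
  refine intervalIntegral.integral_congr_ae ?_
  filter_upwards [h] with x hx _
  have hfour : fourier n (a : UnitAddCircle) * fourier (-n) ((x + a : ℝ) : UnitAddCircle) =
      fourier (-n) (x : UnitAddCircle) := by
    simp only [fourier_coe_apply, ← Complex.exp_add]
    congr 1
    push_cast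
    ring
  rw [hx, ← hfour]
  simp only [smul_eq_mul]
  ring

/-- Rigidity of measurable solutions of the phase cohomological equation: if a 1-periodic
integrable `l : ℝ → ℂ` satisfies `l(x) = e^{4πiθ} l(x+Φ)` a.e. with `Φ` irrational, and
`l` is not a.e. zero, then `2θ + jΦ ∈ ℤ` for some `j ∈ ℤ`. -/
theorem phase_cohomology_rigidity
    (Φ θ : ℝ) (hΦ : Irrational Φ)
    (l : ℝ → ℂ)
    (hper : Function.Periodic l 1)
    (hint : IntegrableOn l (Set.Ioc (0 : ℝ) 1))
    (hcoh : ∀ᵐ x : ℝ, l x = Complex.exp (4 * Real.pi * θ * Complex.I) * l (x + Φ))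
    (hne : ¬ (∀ᵐ x : ℝ, l x = 0)) :
    ∃ j m : ℤ, 2 * θ + (j : ℝ) * Φ = (m : ℝ) := by
  by_contra! hres
  refine hne ?_
  let f : UnitAddCircle → ℂ := AddCircle.liftIoc 1 0 l
  have hfl (x : ℝ) : f x = l x := by
    have h : f x = hper.lift (AddCircle.equivIoc 1 0 (x : UnitAddCircle) : UnitAddCircle) := rfl
    rw [h, AddCircle.coe_equivIoc, hper.lift_coe]
  have hf : Integrable f AddCircle.haarAddCircle := by
    have h1 : MemLp l 1 (volume.restrict (Set.Ioc 0 (0 + 1))) := by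
      rw [zero_add]
      exact memLp_one_iff_integrable.2 hint
    exact memLp_one_iff_integrable.1 (memLp_haarAddCircle_iff.2 h1.memLp_liftIoc)
  have hcoeff (n : ℤ) : fourierCoeff f n = 0 := by
    have h := fourierCoeff_eq_mul_of_ae_eq (f := f) (by simpa only [hfl] using hcoh) n
    by_contra h0
    have h1 := mul_right_cancel₀ h0 ((one_mul _).trans h)
    rw [fourier_coe_apply, ← Complex.exp_add] at h1
    obtain ⟨m, hm⟩ := Complex.exp_eq_one_iff.1 h1.symm
    refine hres n m ?_
    have h2 : (2 * Real.pi * Complex.I) * (2 * θ + n * Φ) = (2 * Real.pi * Complex.I) * m := by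
      rw [mul_comm _ (m : ℂ), ← hm]
      push_cast
      ring
    exact_mod_cast mul_left_cancel₀ Complex.two_pi_I_ne_zero h2
  have hzero : ∀ᵐ x : UnitAddCircle, f x = 0 := by
    rw [AddCircle.volume_eq_smul_haarAddCircle]
    exact Measure.ae_smul_measure (ae_eq_zero_of_fourierCoeff_eq_zero hf hcoeff) _
  simpa only [hfl] using UnitAddCircle.ae_coe hzero
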